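/- Let μ, K, C ∈ ℝ, σ > 0, h > 0, and Y ~ N(μ, σ²). Define Ψ_h(y) = (y − K)·Csinc((y − C)/(σh)) − (σ/h)·sinc((y − C)/(σh)). Then the bias admits the exact representation (μ − K)·Φ((μ − C)/σ) − E[Ψ_h(Y)] = (1/π) ∫_{1/h}^{∞} ω^{−1} e^{−ω²/2} (μ − K) sin(ω(μ − C)/σ) dω, where the integral converges absolutely (Lebesgue). -/

import Mathlib

open MeasureTheory ProbabilityTheory

/-- standard normal density -/
noncomputable def phiR (x : ℝ) : ℝ := (Real.sqrt (2 * Real.pi))⁻¹ * Real.exp (-(x ^ 2) / 2)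

/-- standard normal CDF -/
noncomputable def PhiR (x : ℝ) : ℝ := ∫ t in Set.Iic x, phiR t

/-- sinc kernel, normalized by π -/
noncomputable def sincR (x : ℝ) : ℝ := if x = 0 then 1 / Real.pi else Real.sin x / (Real.pi * x)

/-- sine integral -/
noncomputable def SiR (x : ℝ) : ℝ := ∫ t in (0:ℝ)..x, Real.sin t / t

/-- cumulative sinc -/
noncomputable def CsincR (x : ℝ) : ℝ := 1 / 2 + SiR x / Real.pi

lemma phiR_eq (x : ℝ) : phiR x = gaussianPDFReal 0 1 x := by
  simp [phiR, gaussianPDFReal]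

lemma phiR_nonneg (x : ℝ) : 0 ≤ phiR x := by unfold phiR; positivity

lemma continuous_phiR : Continuous phiR := by unfold phiR; fun_prop

lemma integral_phiR_mul (f : ℝ → ℝ) :
    ∫ z, phiR z * f z = ∫ z, f z ∂(gaussianReal 0 1) := by
  rw [integral_gaussianReal_eq_integral_smul one_ne_zero]
  simp [phiR_eq]

lemma integrable_exp_half : Integrable (fun x : ℝ => Real.exp (-x ^ 2 / 2)) := by
  have := integrable_exp_neg_mul_sq (b := 1/2) (by norm_num)
  convert this using 3
  ring

lemma integrable_phiR : Integrable phiR := by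
  have := integrable_exp_half.const_mul (Real.sqrt (2 * Real.pi))⁻¹
  exact this

lemma integrable_sq_phiR : Integrable (fun z => phiR z * z ^ 2) := by
  have := (integrable_rpow_mul_exp_neg_mul_sq (b := 1/2) (by norm_num) (s := 2)
    (by norm_num)).const_mul (Real.sqrt (2 * Real.pi))⁻¹
  convert this using 2 with z
  unfold phiR
  rw [show -(z^2)/2 = -(1/2) * z^2 by ring]
  norm_num
  ring

lemma integrable_phiR_mul (f : ℝ → ℝ) (hf : Continuous f) (A B : ℝ)
    (h : ∀ z, |f z| ≤ A + B * z ^ 2) : Integrable (fun z => phiR z * f z) := by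
  have h1 := (integrable_phiR.mul_const A).add (integrable_sq_phiR.const_mul B)
  refine h1.mono' (continuous_phiR.mul hf).aestronglyMeasurable (.of_forall fun z => ?_)
  simp only [Real.norm_eq_abs, abs_mul, abs_of_nonneg (phiR_nonneg z), Pi.add_apply]
  nlinarith [mul_le_mul_of_nonneg_left (h z) (phiR_nonneg z)]

lemma charFun_std (t : ℝ) :
    (∫ z, Real.cos (t * z) ∂(gaussianReal 0 1) = Real.exp (-t ^ 2 / 2)) ∧
    (∫ z, Real.sin (t * z) ∂(gaussianReal 0 1) = 0) := by
  have h := charFun_gaussianReal (μ := 0) (v := 1) t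
  rw [charFun_apply_real] at h
  have hi : Integrable (fun x : ℝ => Complex.exp (t * x * Complex.I)) (gaussianReal 0 1) := by
    refine Integrable.of_bound (C := 1) (by fun_prop) (.of_forall fun x => ?_)
    rw [← Complex.ofReal_mul, Complex.norm_exp_ofReal_mul_I]
  have hr := congrArg Complex.re h
  have him := congrArg Complex.im h
  have e : Complex.exp (t * (0:ℝ) * Complex.I - (1 : NNReal) * t ^ 2 / 2)
      = ((Real.exp (-t ^ 2 / 2) : ℝ) : ℂ) := by
    push_cast
    congr 1
    simp; ring
  rw [e] at hr him
  have i1 := integral_re hi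
  have i2 := integral_im hi
  simp only [RCLike.re_to_complex, RCLike.im_to_complex] at i1 i2
  rw [← i1, Complex.ofReal_re] at hr
  rw [← i2, Complex.ofReal_im] at him
  refine ⟨?_, ?_⟩
  · rw [← hr]; congr with x
    rw [← Complex.ofReal_mul, Complex.exp_ofReal_mul_I_re]
  · rw [← him]; congr with x
    rw [← Complex.ofReal_mul, Complex.exp_ofReal_mul_I_im]

lemma integral_sin_shift (t a : ℝ) :
    ∫ z, phiR z * Real.sin (t * (a + z)) = Real.exp (-t ^ 2 / 2) * Real.sin (t * a) := by
  rw [integral_phiR_mul]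
  have : ∀ z, Real.sin (t * (a + z))
      = Real.sin (t * a) * Real.cos (t * z) + Real.cos (t * a) * Real.sin (t * z) := by
    intro z; rw [mul_add, Real.sin_add]
  simp_rw [this]
  rw [integral_add, integral_const_mul, integral_const_mul, (charFun_std t).1, (charFun_std t).2]
  · ring
  · refine (Integrable.of_bound (C := 1) (by fun_prop) (.of_forall fun x => ?_)).const_mul _
    exact Real.abs_cos_le_one _
  · refine (Integrable.of_bound (C := 1) (by fun_prop) (.of_forall fun x => ?_)).const_mul _
    exact Real.abs_sin_le_one _

lemma integral_cos_half (s : ℝ) :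
    ∫ ω in Set.Ioi (0:ℝ), Real.exp (-ω ^ 2 / 2) * Real.cos (ω * s) = Real.pi * phiR s := by
  have h := integral_comp_abs (f := fun ω => Real.exp (-ω ^ 2 / 2) * Real.cos (ω * s))
  have h1 := (charFun_std s).1
  rw [← integral_phiR_mul] at h1
  have h2 : ∀ z : ℝ, phiR z * Real.cos (s * z) = (Real.sqrt (2 * Real.pi))⁻¹ *
      (Real.exp (-|z| ^ 2 / 2) * Real.cos (|z| * s)) := by
    intro z
    have : Real.cos (|z| * s) = Real.cos (s * z) := by
      rcases abs_choice z with h | h <;> rw [h]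
      · rw [mul_comm]
      · rw [neg_mul, Real.cos_neg, mul_comm]
    rw [this, sq_abs]; unfold phiR; ring
  simp_rw [h2] at h1
  rw [integral_const_mul, h] at h1
  have hp : 0 < Real.sqrt (2 * Real.pi) := by positivity
  have hs : Real.sqrt (2 * Real.pi) * Real.sqrt (2 * Real.pi) = 2 * Real.pi :=
    Real.mul_self_sqrt (by positivity)
  unfold phiR
  rw [show -(s ^ 2) / 2 = -s ^ 2 / 2 by ring, ← h1]
  generalize (∫ ω in Set.Ioi (0:ℝ), Real.exp (-ω ^ 2 / 2) * Real.cos (ω * s)) = J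
  have hpi : Real.pi = Real.sqrt (2 * Real.pi) * Real.sqrt (2 * Real.pi) / 2 := by
    rw [hs]; ring
  generalize Real.sqrt (2 * Real.pi) = q at *
  rw [hpi]
  field_simp

lemma mul_sinc_eq_inv (ω a : ℝ) (h : ω ≠ 0) :
    a * Real.sinc (ω * a) = ω⁻¹ * Real.sin (ω * a) := by
  by_cases ha : a = 0
  · simp [ha]
  · rw [Real.sinc_of_ne_zero (by positivity)]; field_simp

lemma integral_cos_eq (ω a : ℝ) (h : ω ≠ 0) :
    ∫ s in (0:ℝ)..a, Real.cos (ω * s) = a * Real.sinc (ω * a) := by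
  rw [mul_sinc_eq_inv ω a h, intervalIntegral.integral_comp_mul_left _ h]
  simp

lemma PhiR_zero_eq : PhiR 0 = 1 / 2 := by
  have h := integral_comp_abs (f := phiR)
  have he : ∀ x, phiR |x| = phiR x := fun x => by simp [phiR]
  simp_rw [he] at h
  have h1 : ∫ x, phiR x = 1 := by
    have := integral_phiR_mul (fun _ => 1)
    simpa using this
  have h2 := intervalIntegral.integral_Iic_add_Ioi (b := (0:ℝ)) integrable_phiR.integrableOn
    integrable_phiR.integrableOn
  unfold PhiR
  linarith

lemma PhiR_eq (a : ℝ) : PhiR a = 1 / 2 + ∫ s in (0:ℝ)..a, phiR s := by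
  have := intervalIntegral.integral_Iic_sub_Iic (a := 0) (b := a) (integrable_phiR.integrableOn)
    integrable_phiR.integrableOn
  have h0 := PhiR_zero_eq
  unfold PhiR at *
  linarith

/-- the frequency integrand, in continuous form -/
noncomputable def frq (a ω : ℝ) : ℝ := Real.exp (-ω ^ 2 / 2) * (a * Real.sinc (ω * a))

lemma continuous_frq (a : ℝ) : Continuous (frq a) := by
  unfold frq
  have := Real.continuous_sinc
  fun_prop

lemma integrable_frq (a : ℝ) : Integrable (frq a) := by
  refine (integrable_exp_half.mul_const |a|).mono' (continuous_frq a).aestronglyMeasurable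
    (.of_forall fun ω => ?_)
  unfold frq
  rw [Real.norm_eq_abs, abs_mul, Real.abs_exp, abs_mul]
  have := Real.abs_sinc_le_one (ω * a)
  gcongr
  exact mul_le_of_le_one_right (abs_nonneg _) this

lemma PhiR_frq (a : ℝ) : PhiR a = 1 / 2 + (1 / Real.pi) * ∫ ω in Set.Ioi (0:ℝ), frq a ω := by
  rw [PhiR_eq]
  have h1 : ∫ ω in Set.Ioi (0:ℝ), frq a ω
      = ∫ ω in Set.Ioi (0:ℝ), ∫ s in (0:ℝ)..a, Real.exp (-ω ^ 2 / 2) * Real.cos (ω * s) := by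
    refine setIntegral_congr_fun measurableSet_Ioi fun ω hω => ?_
    have : ω ≠ 0 := ne_of_gt hω
    simp only [frq]
    rw [intervalIntegral.integral_const_mul, integral_cos_eq ω a this]
  rw [h1, ← intervalIntegral_integral_swap]
  · simp_rw [integral_cos_half]
    rw [intervalIntegral.integral_const_mul]
    field_simp
  · have hb : Integrable (fun p : ℝ × ℝ => (1:ℝ) * Real.exp (-p.2 ^ 2 / 2))
        ((volume.restrict (Set.uIoc 0 a)).prod (volume.restrict (Set.Ioi (0:ℝ)))) := by
      refine Integrable.mul_prod (f := fun _ : ℝ => (1:ℝ))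
        (g := fun x : ℝ => Real.exp (-x ^ 2 / 2)) ?_ integrable_exp_half.integrableOn
      exact integrableOn_const (by simp [Set.uIoc])
    refine hb.mono' (Continuous.aestronglyMeasurable (by unfold Function.uncurry; fun_prop))
      (.of_forall fun p => ?_)
    simp only [Function.uncurry, Real.norm_eq_abs, abs_mul, Real.abs_exp, one_mul]
    exact mul_le_of_le_one_right (Real.exp_pos _).le (Real.abs_cos_le_one _)

lemma SiR_eq (x : ℝ) : SiR x = ∫ t in (0:ℝ)..x, Real.sinc t := by
  unfold SiR
  refine intervalIntegral.integral_congr_ae ?_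
  have : ∀ᵐ t : ℝ, t ≠ 0 := by simp [ae_iff]
  filter_upwards [this] with t ht _
  rw [Real.sinc_of_ne_zero ht]

lemma hasDerivAt_SiR (x : ℝ) : HasDerivAt SiR (Real.sinc x) x := by
  have : SiR = fun x => ∫ t in (0:ℝ)..x, Real.sinc t := funext SiR_eq
  rw [this]
  exact Real.continuous_sinc.integral_hasStrictDerivAt 0 x |>.hasDerivAt

lemma continuous_SiR : Continuous SiR :=
  continuous_iff_continuousAt.2 fun x => (hasDerivAt_SiR x).continuousAt

lemma abs_SiR_le (x : ℝ) : |SiR x| ≤ |x| := by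
  rw [SiR_eq]
  have := intervalIntegral.norm_integral_le_of_norm_le_const (a := 0) (b := x) (C := 1)
    (f := Real.sinc) (fun t _ => Real.abs_sinc_le_one t)
  simpa using this

lemma sincR_eq (x : ℝ) : sincR x = Real.sinc x / Real.pi := by
  unfold sincR Real.sinc
  split_ifs
  · rfl
  · field_simp

lemma SiR_scale (x T : ℝ) : SiR (x * T) = ∫ ω in (0:ℝ)..T, x * Real.sinc (ω * x) := by
  rw [intervalIntegral.integral_const_mul, intervalIntegral.mul_integral_comp_mul_right, SiR_eq]
  simp [mul_comm]

lemma integral_SiR (a T : ℝ) :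
    ∫ z, phiR z * SiR ((a + z) * T) = ∫ ω in (0:ℝ)..T, frq a ω := by
  simp_rw [SiR_scale, ← intervalIntegral.integral_const_mul]
  rw [← intervalIntegral_integral_swap]
  · refine intervalIntegral.integral_congr_ae ?_
    have : ∀ᵐ t : ℝ, t ≠ 0 := by simp [ae_iff]
    filter_upwards [this] with ω hω _
    simp_rw [frq, mul_sinc_eq_inv ω _ hω, mul_left_comm _ ω⁻¹]
    rw [integral_const_mul, integral_sin_shift]
  · have hb : Integrable (fun p : ℝ × ℝ => (1:ℝ) * (phiR p.2 * (|a| + 1 + p.2 ^ 2)))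
        ((volume.restrict (Set.uIoc 0 T)).prod volume) := by
      refine Integrable.mul_prod (f := fun _ : ℝ => (1:ℝ))
        (g := fun x : ℝ => phiR x * (|a| + 1 + x ^ 2)) ?_ ?_
      · exact integrableOn_const (by simp [Set.uIoc])
      · refine integrable_phiR_mul _ (by fun_prop) (|a| + 1) 1 fun z => ?_
        rw [abs_of_nonneg (by positivity), one_mul]
    have c1 := Real.continuous_sinc
    have c2 := continuous_phiR
    refine hb.mono' (Continuous.aestronglyMeasurable (by unfold Function.uncurry; fun_prop))
      (.of_forall fun p => ?_)
    simp only [Function.uncurry, Real.norm_eq_abs, abs_mul, one_mul,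
      abs_of_nonneg (phiR_nonneg p.2)]
    refine mul_le_mul_of_nonneg_left ?_ (phiR_nonneg _)
    refine (mul_le_of_le_one_right (abs_nonneg _) (Real.abs_sinc_le_one _)).trans ?_
    refine (abs_add_le _ _).trans ?_
    have : |p.2| ≤ 1 + p.2 ^ 2 := by rw [← sq_abs]; nlinarith [sq_nonneg (|p.2| - 1)]
    linarith

lemma hasDerivAt_phiR (z : ℝ) : HasDerivAt phiR (-z * phiR z) z := by
  unfold phiR
  have h : HasDerivAt (fun x : ℝ => -(x ^ 2) / 2) (-z) z := by
    exact ((hasDerivAt_pow 2 z).neg.div_const 2).congr_deriv (by simp; ring)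
  exact (h.exp.const_mul (Real.sqrt (2 * Real.pi))⁻¹).congr_deriv (by ring)

lemma abs_SiR_lin (a T z : ℝ) : |SiR ((a + z) * T)| ≤ (|a| + |z|) * |T| := by
  refine (abs_SiR_le _).trans ?_
  rw [abs_mul]
  gcongr
  exact abs_add_le _ _

lemma abs_CsincR_lin (a T : ℝ) :
    ∃ M, 0 ≤ M ∧ ∀ z, |CsincR ((a + z) * T)| ≤ M * (1 + |z|) := by
  refine ⟨1 / 2 + (|a| + 1) * |T|, by positivity, fun z => ?_⟩
  unfold CsincR
  have h1 := abs_SiR_lin a T z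
  have hpi : (1:ℝ) ≤ Real.pi := by linarith [Real.pi_gt_three]
  have h2 : |SiR ((a + z) * T) / Real.pi| ≤ |SiR ((a + z) * T)| := by
    rw [abs_div, abs_of_pos Real.pi_pos]
    exact div_le_self (abs_nonneg _) hpi
  have h3 := abs_add_le (1 / 2) (SiR ((a + z) * T) / Real.pi)
  have h4 : |(1:ℝ) / 2| = 1 / 2 := by norm_num
  rw [h4] at h3
  have : 0 ≤ |T| * |z| := by positivity
  have : 0 ≤ |T| * |a| * |z| := by positivity
  have : 0 ≤ |T| := by positivity
  nlinarith [abs_nonneg z]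

lemma continuous_CsincR : Continuous CsincR := by
  unfold CsincR
  have := continuous_SiR
  fun_prop

lemma int_Csinc (a T : ℝ) : Integrable (fun z => phiR z * CsincR ((a + z) * T)) := by
  obtain ⟨M, hM, h⟩ := abs_CsincR_lin a T
  have := continuous_CsincR
  refine integrable_phiR_mul _ (by fun_prop) (2 * M) M fun z => (h z).trans ?_
  rw [← sq_abs]
  nlinarith [mul_nonneg hM (sq_nonneg (|z| - 1)), mul_nonneg hM (sq_nonneg (|z|))]

lemma int_z_Csinc (a T : ℝ) : Integrable (fun z => phiR z * (z * CsincR ((a + z) * T))) := by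
  obtain ⟨M, hM, h⟩ := abs_CsincR_lin a T
  have := continuous_CsincR
  refine integrable_phiR_mul _ (by fun_prop) M (2 * M) fun z => ?_
  rw [abs_mul]
  refine (mul_le_mul_of_nonneg_left (h z) (abs_nonneg _)).trans ?_
  rw [← sq_abs]
  nlinarith [mul_nonneg hM (sq_nonneg (|z| - 1)), mul_nonneg hM (sq_nonneg (|z|))]

lemma int_sinc (a T : ℝ) : Integrable (fun z => phiR z * (T * sincR ((a + z) * T))) := by
  simp_rw [sincR_eq]
  have := Real.continuous_sinc
  refine integrable_phiR_mul _ (by fun_prop) (|T| / Real.pi) 0 fun z => ?_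
  rw [abs_mul, abs_div, abs_of_pos Real.pi_pos, zero_mul, add_zero, mul_div_assoc']
  gcongr
  exact mul_le_of_le_one_right (abs_nonneg _) (Real.abs_sinc_le_one _)

lemma stein (a T : ℝ) :
    ∫ z, phiR z * (T * sincR ((a + z) * T) - z * CsincR ((a + z) * T)) = 0 := by
  refine integral_eq_zero_of_hasDerivAt_of_integrable
    (f := fun z => phiR z * CsincR ((a + z) * T)) (fun z => ?_) ?_ (int_Csinc a T)
  · have h1 : HasDerivAt (fun z => (a + z) * T) T z := by
      simpa using ((hasDerivAt_id z).const_add a).mul_const T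
    have h2 : HasDerivAt (fun z => CsincR ((a + z) * T)) (Real.sinc ((a + z) * T) * T / Real.pi) z :=
      (((hasDerivAt_SiR _).comp z h1).div_const Real.pi).const_add (1 / 2)
    exact ((hasDerivAt_phiR z).mul h2).congr_deriv (by rw [sincR_eq]; ring)
  · simp_rw [mul_sub]
    exact (int_sinc a T).sub (int_z_Csinc a T)

lemma integral_Csinc (a T : ℝ) :
    ∫ z, phiR z * CsincR ((a + z) * T) = 1 / 2 + (1 / Real.pi) * ∫ ω in (0:ℝ)..T, frq a ω := by
  rw [← integral_SiR]
  have h1 : ∫ x, phiR x = 1 := by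
    have := integral_phiR_mul (fun _ => 1)
    simpa using this
  have hi : Integrable (fun z => phiR z * SiR ((a + z) * T)) := by
    have := ((int_Csinc a T).sub (integrable_phiR.mul_const (1/2))).const_mul Real.pi
    convert this using 2 with z
    simp only [CsincR, Pi.sub_apply]
    field_simp
    ring
  have : ∀ z, phiR z * CsincR ((a + z) * T)
      = phiR z * (1 / 2) + (1 / Real.pi) * (phiR z * SiR ((a + z) * T)) := by
    intro z; unfold CsincR; ring
  simp_rw [this]
  rw [integral_add (integrable_phiR.mul_const _) (hi.const_mul _), integral_mul_const,
    integral_const_mul, h1, one_mul]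

lemma gauss_std (μ σ : ℝ) (f : ℝ → ℝ) (hf : Continuous f) :
    ∫ y, f y ∂(gaussianReal μ ((σ ^ 2).toNNReal)) = ∫ z, phiR z * f (μ + σ * z) := by
  rw [integral_phiR_mul (fun z => f (μ + σ * z))]
  have h : gaussianReal μ ((σ ^ 2).toNNReal)
      = (gaussianReal 0 1).map (fun z => μ + σ * z) := by
    have h1 := gaussianReal_map_const_mul (μ := 0) (v := 1) σ
    have h2 := gaussianReal_map_const_add (μ := σ * 0)
      (v := .mk (σ ^ 2) (sq_nonneg σ) * 1) μ
    rw [← h1, Measure.map_map (by fun_prop) (by fun_prop)] at h2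
    have e : (σ ^ 2).toNNReal = .mk (σ ^ 2) (sq_nonneg σ) * 1 := by
      ext; simp [sq_nonneg]
    rw [e]
    rw [mul_zero, zero_add] at h2
    rw [← h2]
    rfl
  rw [h, integral_map (by fun_prop) hf.aestronglyMeasurable]

/-- exact representation of the ASSURE bias as a tail frequency integral. -/
theorem assure_bias_exact (μ K C σ h : ℝ) (hσ : 0 < σ) (hh : 0 < h) :
    IntegrableOn
      (fun ω : ℝ => ω⁻¹ * Real.exp (-ω ^ 2 / 2) * ((μ - K) * Real.sin (ω * (μ - C) / σ)))
      (Set.Ioi (1 / h)) ∧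
    (μ - K) * PhiR ((μ - C) / σ)
        - (∫ y, ((y - K) * CsincR ((y - C) / (σ * h)) - (σ / h) * sincR ((y - C) / (σ * h)))
            ∂(gaussianReal μ ((σ ^ 2).toNNReal)))
      = (1 / Real.pi) * ∫ ω in Set.Ioi (1 / h),
          ω⁻¹ * Real.exp (-ω ^ 2 / 2) * ((μ - K) * Real.sin (ω * (μ - C) / σ)) := by
  have hT : 0 < 1 / h := by positivity
  have hfun : Set.EqOn (fun ω => (μ - K) * frq ((μ - C) / σ) ω)
      (fun ω : ℝ => ω⁻¹ * Real.exp (-ω ^ 2 / 2) * ((μ - K) * Real.sin (ω * (μ - C) / σ)))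
      (Set.Ioi (1 / h)) := by
    intro ω hω
    have h0 : ω ≠ 0 := (hT.trans hω).ne'
    simp only [frq]
    rw [mul_sinc_eq_inv ω _ h0, mul_div_assoc']
    ring
  refine ⟨((integrable_frq _).const_mul _).integrableOn.congr_fun hfun measurableSet_Ioi, ?_⟩
  rw [← setIntegral_congr_fun measurableSet_Ioi hfun, integral_const_mul]
  have c1 := continuous_CsincR
  have c2 : Continuous sincR := by
    rw [show sincR = fun x => Real.sinc x / Real.pi from funext sincR_eq]
    exact Real.continuous_sinc.div_const _
  rw [gauss_std μ σ (fun y => (y - K) * CsincR ((y - C) / (σ * h))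
    - (σ / h) * sincR ((y - C) / (σ * h))) (by fun_prop)]
  set a := (μ - C) / σ with ha
  have hz : ∀ z, phiR z * ((μ + σ * z - K) * CsincR ((μ + σ * z - C) / (σ * h))
      - (σ / h) * sincR ((μ + σ * z - C) / (σ * h)))
      = (μ - K) * (phiR z * CsincR ((a + z) * (1 / h)))
        - σ * (phiR z * ((1 / h) * sincR ((a + z) * (1 / h)) - z * CsincR ((a + z) * (1 / h)))) := by
    intro z
    have : (μ + σ * z - C) / (σ * h) = (a + z) * (1 / h) := by
      rw [ha]; field_simp; ring
    rw [this]; ring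
  simp_rw [hz]
  have hi2 : Integrable (fun z => phiR z * ((1 / h) * sincR ((a + z) * (1 / h))
      - z * CsincR ((a + z) * (1 / h)))) := by
    simp_rw [mul_sub]
    exact (int_sinc a (1 / h)).sub (int_z_Csinc a (1 / h))
  rw [integral_sub ((int_Csinc a (1 / h)).const_mul _) (hi2.const_mul _), integral_const_mul,
    integral_const_mul, stein, integral_Csinc, PhiR_frq]
  have := intervalIntegral.integral_interval_add_Ioi (a := 0) (b := 1 / h)
    (integrable_frq a).integrableOn (integrable_frq a).integrableOn
  rw [← this]
  ring
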